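/- arXiv:1412.6083 — 7 statements merged into one kernel-verified Lean document; each statement's English description precedes it below -/
import Mathlib

section
/- Let R be a finite ring with unity and A a finite left R-module. If A can be embedded into the character module R̂ as a left R-module (i.e., there is an injective R-linear map A → R̂), then A has the extension property with respect to the symmetrized weight composition built on any subgroup G of Aut_R(A). -/
open Function

/-- The annihilator of an element `a` of a left `R`-module, as a left ideal of `R`. -/
def elemAnn (R : Type*) [Ring R] {A : Type*} [AddCommGroup A] [Module R A] (a : A) :
    Submodule R R where
  carrier := {r | r • a = 0}
  add_mem' := fun {x y} hx hy => by
    simp only [Set.mem_setOf_eq] at *; rw [add_smul, hx, hy, add_zero]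
  zero_mem' := by simp
  smul_mem' := fun c r hr => by
    simp only [Set.mem_setOf_eq, smul_eq_mul] at *
    rw [mul_smul, hr, smul_zero]

/-- The symmetrized weight composition built on a subgroup `G ≤ Aut_R(A)`. -/
noncomputable def swc (R : Type*) [Ring R] {A : Type*} [AddCommGroup A] [Module R A]
    (G : Subgroup (A ≃ₗ[R] A)) {n : ℕ} (x : Fin n → A) (a : A) : ℕ :=
  Nat.card {i : Fin n // ∃ τ ∈ G, x i = τ a}

/-- The Hamming weight of a word. -/
noncomputable def hwt {A : Type*} [Zero A] {n : ℕ} (x : Fin n → A) : ℕ :=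
  Nat.card {i : Fin n // x i ≠ 0}

/-- The annihilator weight of a word. -/
noncomputable def aw (R : Type*) [Ring R] {A : Type*} [AddCommGroup A] [Module R A]
    {n : ℕ} (x : Fin n → A) (a : A) : ℕ :=
  Nat.card {i : Fin n // elemAnn R (x i) = elemAnn R a}

/-- `f : C → A^n` is the restriction of a `G`-monomial transformation of `A^n`. -/
def ExtendsToMonomial (R : Type*) [Ring R] {A : Type*} [AddCommGroup A] [Module R A]
    (G : Subgroup (A ≃ₗ[R] A)) {n : ℕ} (C : Submodule R (Fin n → A))
    (f : C →ₗ[R] (Fin n → A)) : Prop :=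
  ∃ (σ : Equiv.Perm (Fin n)) (τ : Fin n → G),
    ∀ (x : C) (i : Fin n), f x i = (τ i : A ≃ₗ[R] A) ((x : Fin n → A) (σ i))

/-- The extension property with respect to the symmetrized weight composition built on `G`. -/
def HasEPswc (R : Type*) [Ring R] (A : Type*) [AddCommGroup A] [Module R A]
    (G : Subgroup (A ≃ₗ[R] A)) : Prop :=
  ∀ (n : ℕ) (C : Submodule R (Fin n → A)) (f : C →ₗ[R] (Fin n → A)),
    Injective f → (∀ (x : C) (a : A), swc R G (f x) a = swc R G (x : Fin n → A) a) →
    ExtendsToMonomial R G C f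

/-- The extension property with respect to the Hamming weight. -/
def HasEPHamming (R : Type*) [Ring R] (A : Type*) [AddCommGroup A] [Module R A] : Prop :=
  ∀ (n : ℕ) (C : Submodule R (Fin n → A)) (f : C →ₗ[R] (Fin n → A)),
    Injective f → (∀ x : C, hwt (f x) = hwt (x : Fin n → A)) →
    ExtendsToMonomial R (⊤ : Subgroup (A ≃ₗ[R] A)) C f

/-- The extension property with respect to the annihilator weight. -/
def HasEPaw (R : Type*) [Ring R] (A : Type*) [AddCommGroup A] [Module R A] : Prop :=
  ∀ (n : ℕ) (C : Submodule R (Fin n → A)) (f : C →ₗ[R] (Fin n → A)),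
    Injective f → (∀ (x : C) (a : A), aw R (f x) a = aw R (x : Fin n → A) a) →
    ExtendsToMonomial R (⊤ : Subgroup (A ≃ₗ[R] A)) C f

/-- A module is pseudo-injective if every injective linear map from a submodule into the
module extends to an endomorphism. -/
def PseudoInjective (R : Type*) [Ring R] (A : Type*) [AddCommGroup A] [Module R A] : Prop :=
  ∀ (B : Submodule R A) (g : B →ₗ[R] A), Injective g →
    ∃ h : A →ₗ[R] A, ∀ b : B, h b = g b

/-- `A` embeds, as a left `R`-module, into the character module
`R̂ = Hom((R,+), ℚ/ℤ)` with `(r • χ) x = χ (x * r)`. -/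
def EmbedsInCharacterModule (R : Type*) [Ring R] (A : Type*) [AddCommGroup A]
    [Module R A] : Prop :=
  ∃ ι : A →+ (R →+ AddCircle (1 : ℚ)),
    Injective ι ∧ ∀ (r : R) (a : A) (x : R), ι (r • a) x = ι a (x * r)

/-- A chain ring: the left ideals are linearly ordered by inclusion. -/
def IsChainRing (R : Type*) [Ring R] : Prop :=
  ∀ I J : Submodule R R, I ≤ J ∨ J ≤ I

/-- Two families with equally large fibres differ by a permutation of the index set. -/
lemma exists_perm_of_card_fiber_eq {ι X : Type*} [Finite ι] (u v : ι → X)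
    (h : ∀ y, Nat.card {i // u i = y} = Nat.card {i // v i = y}) :
    ∃ σ : Equiv.Perm ι, ∀ i, v (σ i) = u i :=
  ⟨Equiv.ofFiberEquiv fun y => (Finite.card_eq.1 (h y)).some, Equiv.ofFiberEquiv_map _⟩

/-- The embedding `ℚ/ℤ → ℝ/ℤ`. -/
noncomputable def ratAddCircleToReal : AddCircle (1 : ℚ) →+ AddCircle (1 : ℝ) :=
  QuotientAddGroup.map _ _ (Rat.castHom ℝ).toAddMonoidHom <| by
    rw [AddSubgroup.zmultiples_le]
    exact AddSubgroup.mem_zmultiples_iff.2 ⟨1, by simp⟩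

lemma ratAddCircleToReal_injective : Injective ratAddCircleToReal := by
  rw [injective_iff_map_eq_zero]
  intro a
  induction a using QuotientAddGroup.induction_on with
  | H q =>
    intro h
    obtain ⟨n, hn⟩ := (AddCircle.coe_eq_zero_iff (1 : ℝ) (x := (q : ℝ))).1 h
    refine (AddCircle.coe_eq_zero_iff (1 : ℚ)).2 ⟨n, ?_⟩
    simp only [zsmul_eq_mul, mul_one] at hn ⊢
    exact_mod_cast hn

/-- The standard faithful complex character of `ℚ/ℤ`. -/
noncomputable def ratAddCircleChar : AddChar (AddCircle (1 : ℚ)) ℂ where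
  toFun t := (AddCircle.toCircle (ratAddCircleToReal t) : ℂ)
  map_zero_eq_one' := by simp
  map_add_eq_mul' a b := by simp [AddCircle.toCircle_add]

lemma ratAddCircleChar_injective : Injective ratAddCircleChar := fun _ _ h =>
  ratAddCircleToReal_injective
    (AddCircle.injective_toCircle one_ne_zero (Circle.coe_injective h))

section

variable {R A : Type*} [Ring R] [AddCommGroup A] [Module R A]

/-- Composing linear maps into `A` with a complex character of `A` whose kernel contains no nonzero
submodule gives linearly independent functions. -/
lemma linearIndependent_addChar_comp {M : Type*} [AddCommGroup M] [Finite M] [Module R M]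
    (ψ : AddChar A ℂ) (hψ : ∀ a b : A, (∀ r : R, ψ (r • a) = ψ (r • b)) → a = b) :
    LinearIndependent ℂ fun (l : M →ₗ[R] A) (x : M) => ψ (l x) := by
  refine (AddChar.linearIndependent M ℂ).comp
    (fun l : M →ₗ[R] A => ψ.compAddMonoidHom l.toAddMonoidHom) fun l m hlm => ?_
  ext x
  refine hψ _ _ fun r => ?_
  simpa using DFunLike.congr_fun hlm (r • x)

/-- Families with equal symmetrized weight compositions have equal sums of any orbit-invariant
function. -/
lemma sum_eq_of_swc_eq {n : ℕ} {N : Type*} [AddCommMonoid N] (G : Subgroup (A ≃ₗ[R] A))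
    (x y : Fin n → A) (hxy : ∀ a, swc R G x a = swc R G y a)
    (w : A → N) (hw : ∀ (τ : G) a, w (τ • a) = w a) :
    ∑ i, w (x i) = ∑ i, w (y i) := by
  have key (z : Fin n → A) (a : A) :
      Nat.card {i // MulAction.orbit G (z i) = MulAction.orbit G a} = swc R G z a := by
    refine Nat.card_congr (Equiv.subtypeEquivRight fun i => ?_)
    rw [MulAction.orbit_eq_iff]
    constructor
    · rintro ⟨τ, hτ⟩
      exact ⟨τ, τ.2, hτ.symm⟩
    · rintro ⟨τ, hτ, h⟩
      exact ⟨⟨τ, hτ⟩, h.symm⟩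
  obtain ⟨σ, hσ⟩ := exists_perm_of_card_fiber_eq (fun i => MulAction.orbit G (x i))
    (fun i => MulAction.orbit G (y i)) fun s => by
      by_cases hs : ∃ a, s = MulAction.orbit G a
      · obtain ⟨a, rfl⟩ := hs
        rw [key, key, hxy]
      · have h0 (z : Fin n → A) : IsEmpty {i // MulAction.orbit G (z i) = s} :=
          ⟨fun i => hs ⟨_, i.2.symm⟩⟩
        have := h0 x
        have := h0 y
        simp
  rw [← Equiv.sum_comp σ fun i => w (y i)]
  refine Finset.sum_congr rfl fun i _ => ?_
  obtain ⟨τ, hτ⟩ := MulAction.orbit_eq_iff.1 (hσ i)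
  rw [← hτ]
  exact (hw τ (x i)).symm

/-- Two finite families of linear maps into `A` whose values have equal symmetrized weight
compositions agree up to a permutation and automorphisms in `G`. -/
lemma exists_perm_of_swc_eq [Finite A] {M : Type*} [AddCommGroup M] [Finite M] [Module R M]
    (ψ : AddChar A ℂ) (hψ : ∀ a b : A, (∀ r : R, ψ (r • a) = ψ (r • b)) → a = b)
    (G : Subgroup (A ≃ₗ[R] A)) {n : ℕ} (l m : Fin n → M →ₗ[R] A)
    (h : ∀ x a, swc R G (fun i => l i x) a = swc R G (fun i => m i x) a) :
    ∃ (σ : Equiv.Perm (Fin n)) (τ : Fin n → G), ∀ x i, l i x = τ i • m (σ i) x := by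
  classical
  have : Finite (A ≃ₗ[R] A) := DFunLike.finite _
  have := Fintype.ofFinite G
  let o (k : M →ₗ[R] A) : Set (M → A) := MulAction.orbit G (k : M → A)
  let F (k : Fin n → M →ₗ[R] A) : (M →ₗ[R] A) →₀ ℂ :=
    ∑ i, ∑ τ : G, Finsupp.single ((τ : A ≃ₗ[R] A).toLinearMap ∘ₗ k i) 1
  have hF : F l = F m := by
    refine linearIndependent_addChar_comp (M := M) ψ hψ ?_
    ext x
    simp only [F, map_sum, Finsupp.linearCombination_single, one_smul, Finset.sum_apply]
    refine sum_eq_of_swc_eq G _ _ (h x) (fun a => ∑ τ : G, ψ (τ • a)) fun τ a => ?_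
    simp only [smul_smul]
    exact Equiv.sum_comp (Equiv.mulRight τ) fun τ => ψ (τ • a)
  have ho (k : Fin n → M →ₗ[R] A) :
      Finsupp.mapDomain o (F k) = Fintype.card G • ∑ i, Finsupp.single (o (k i)) (1 : ℂ) := by
    simp only [F, Finsupp.mapDomain_finsetSum, Finsupp.mapDomain_single, Finset.smul_sum]
    refine Finset.sum_congr rfl fun i _ => ?_
    rw [Finset.sum_congr rfl fun τ _ => ?_, Finset.sum_const, Finset.card_univ]
    congr 1
    exact MulAction.orbit_eq_iff.2 ⟨τ, rfl⟩
  have hcard (s : Set (M → A)) : Nat.card {i // o (l i) = s} = Nat.card {i // o (m i) = s} := by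
    have hs : (∑ i, Finsupp.single (o (l i)) (1 : ℂ)) = ∑ i, Finsupp.single (o (m i)) (1 : ℂ) := by
      have hlm := (ho l).symm.trans ((congrArg _ hF).trans (ho m))
      exact smul_right_injective _ Fintype.card_ne_zero hlm
    have hs' := DFunLike.congr_fun hs s
    simp only [Finsupp.finsetSum_apply, Finsupp.single_apply, Finset.sum_boole] at hs'
    rw [Nat.card_eq_fintype_card, Nat.card_eq_fintype_card, Fintype.card_subtype,
      Fintype.card_subtype]
    exact_mod_cast hs'
  obtain ⟨σ, hσ⟩ := exists_perm_of_card_fiber_eq _ _ hcard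
  choose τ hτ using fun i => MulAction.orbit_eq_iff.1 (hσ i).symm
  exact ⟨σ, τ, fun x i => (congrFun (hτ i) x).symm⟩

end

/-- If a finite left module `A` over a finite ring `R` embeds into the character module `R̂`,
then `A` has the extension property with respect to the symmetrized weight composition built
on any subgroup `G` of `Aut_R(A)`. -/
theorem ep_swc_of_embeds_in_character_module
    (R : Type*) [Ring R] [Finite R] (A : Type*) [AddCommGroup A] [Finite A] [Module R A]
    (h : EmbedsInCharacterModule R A) (G : Subgroup (A ≃ₗ[R] A)) :
    HasEPswc R A G := by
  intro n C f _ hf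
  obtain ⟨ι, hι, hsmul⟩ := h
  refine exists_perm_of_swc_eq
    (ratAddCircleChar.compAddMonoidHom ((AddMonoidHom.eval (1 : R)).comp ι)) (fun a b hab => ?_) G
    (fun i => LinearMap.proj i ∘ₗ f) (fun i => LinearMap.proj i ∘ₗ C.subtype) hf
  refine hι (AddMonoidHom.ext fun r => ?_)
  simpa [hsmul] using ratAddCircleChar_injective (hab r)
end

section
/- Let R be a finite ring with unity and A a finite left R-module. If A has the extension property with respect to Hamming weight, then A has the extension property with respect to the symmetrized weight composition built on the full automorphism group Aut_R(A). -/
open Function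

/-- The Hamming weight and the symmetrized weight composition at zero add up to the length. -/
theorem swc_zero_add_hwt {R A : Type*} [Ring R] [AddCommGroup A] [Module R A]
    (G : Subgroup (A ≃ₗ[R] A)) {n : ℕ} (x : Fin n → A) : swc R G x 0 + hwt x = n := by
  classical
  have hzero : swc R G x 0 = Nat.card {i : Fin n // x i = 0} :=
    Nat.card_congr <| Equiv.subtypeEquivRight fun i =>
      ⟨fun ⟨τ, _, hτ⟩ => hτ.trans (map_zero τ), fun hi => ⟨1, G.one_mem, hi⟩⟩
  rw [hzero, hwt, ← Nat.card_sum, Nat.card_congr (Equiv.sumCompl fun i => x i = 0),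
    Nat.card_eq_fintype_card, Fintype.card_fin]

/-- The extension property with respect to Hamming weight implies the extension property with
respect to the symmetrized weight composition built on the full automorphism group. -/
theorem ep_swc_of_ep_hamming
    (R : Type*) [Ring R] [Finite R] (A : Type*) [AddCommGroup A] [Finite A] [Module R A]
    (h : HasEPHamming R A) :
    HasEPswc R A (⊤ : Subgroup (A ≃ₗ[R] A)) := by
  intro n C f hf hswc
  refine h n C f hf fun x => ?_
  have hadd := (swc_zero_add_hwt (R := R) ⊤ (f x)).trans
    (swc_zero_add_hwt (R := R) ⊤ (x : Fin n → A)).symm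
  rwa [hswc x 0, Nat.add_left_cancel_iff] at hadd
end

section
/- Let R be a finite ring with unity and A a finite left R-module. If A has the extension property with respect to Hamming weight, then A has the extension property with respect to the annihilator weight aw. -/
open Function

/-- An element has the same annihilator as `0` exactly when it vanishes. -/
theorem elemAnn_eq_elemAnn_zero_iff (R : Type*) [Ring R] {A : Type*} [AddCommGroup A]
    [Module R A] (a : A) : elemAnn R a = elemAnn R (0 : A) ↔ a = 0 := by
  refine ⟨fun h => ?_, fun h => by rw [h]⟩
  have h1 : (1 : R) ∈ elemAnn R (0 : A) := smul_zero (1 : R)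
  rw [← h] at h1
  have h2 : (1 : R) • a = 0 := h1
  rwa [one_smul] at h2

/-- The annihilator weight at `0` counts the zero components, which complement those counted by
the Hamming weight. -/
theorem aw_zero_add_hwt (R : Type*) [Ring R] {A : Type*} [AddCommGroup A] [Module R A] {n : ℕ}
    (x : Fin n → A) : aw R x 0 + hwt x = n := by
  classical
  simp only [aw, hwt, elemAnn_eq_elemAnn_zero_iff, ne_eq]
  rw [← Nat.card_sum, Nat.card_congr (Equiv.sumCompl fun i => x i = 0), Nat.card_fin]

/-- The extension property with respect to Hamming weight implies the extension property with
respect to the annihilator weight. -/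
theorem ep_aw_of_ep_hamming
    (R : Type*) [Ring R] [Finite R] (A : Type*) [AddCommGroup A] [Finite A] [Module R A]
    (h : HasEPHamming R A) :
    HasEPaw R A := by
  intro n C f hf haw
  refine h n C f hf fun x => ?_
  have h_source := aw_zero_add_hwt R (x : Fin n → A)
  have h_image := aw_zero_add_hwt R (f x)
  rw [haw x 0] at h_image
  omega
end

section
/- Let R be a finite ring with unity and A a finite pseudo-injective left R-module. Then for any two elements a, b ∈ A, Ann(a) = Ann(b) if and only if there exists τ ∈ Aut_R(A) with a = τ(b). -/
open Function

open Submodule in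
/-- An injective partial linear map whose domain misses a nonzero submodule extends to an injective
partial linear map on a strictly larger domain, provided its inverse extends to an endomorphism. -/
theorem LinearPMap.exists_injective_lt_of_not_essential
    {R A : Type*} [Ring R] [AddCommGroup A] [Finite A] [Module R A]
    (f : A →ₗ.[R] A) (hf : Injective f) (k : A →ₗ[R] A) (hk : ∀ x : f.domain, k (f x) = x)
    (K : Submodule R A) (hK : K ≠ ⊥) (hd : Disjoint f.domain K) :
    ∃ g : A →ₗ.[R] A, f ≤ g ∧ f.domain < g.domain ∧ Injective g := by
  obtain ⟨S, hS, hSK⟩ := (eq_bot_or_exists_atom_le K).resolve_left hK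
  replace hd : Disjoint f.domain S := hd.mono_right hSK
  set B' : Submodule R A := LinearMap.range f.toFun
  have hmem : ∀ z ∈ B', k z ∈ f.domain ∧ ∀ w ∈ B', k z = k w → z = w := by
    rintro _ ⟨x, rfl⟩
    refine ⟨(hk x).symm ▸ x.2, ?_⟩
    rintro _ ⟨y, rfl⟩ h
    have hxy : x = y := Subtype.ext ((hk x).symm.trans (h.trans (hk y)))
    rw [hxy]
  -- the orbit of `S` under `k` must leave the range of `f`
  have hex : ∃ n : ℕ, ¬ S ≤ B'.comap (k ^ n) := by
    by_contra! hall
    obtain ⟨x, hxS, hx0⟩ := exists_mem_ne_zero_of_ne_bot hS.1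
    have hcancel : ∀ i d : ℕ, (k ^ i) x = (k ^ (i + d)) x → x = (k ^ d) x := by
      intro i
      induction i with
      | zero => intro d h; simpa using h
      | succ i ih =>
        intro d h
        apply ih
        refine (hmem _ (hall i hxS)).2 _ (hall (i + d) hxS) ?_
        rw [show i + 1 + d = (i + d) + 1 by omega, pow_succ', pow_succ'] at h
        exact h
    obtain ⟨i, j, hij, h⟩ := Finite.exists_ne_map_eq_of_infinite (fun n : ℕ => (k ^ n) x)
    wlog hlt : i < j generalizing i j
    · exact this j i hij.symm h.symm (by omega)
    obtain ⟨d, rfl⟩ := Nat.exists_eq_add_of_lt hlt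
    have hx := hcancel i (d + 1) h
    rw [pow_succ'] at hx
    have hxB : x ∈ f.domain := by
      rw [hx]
      exact (hmem _ (hall d hxS)).1
    exact hx0 (disjoint_def.1 hd x hxB hxS)
  classical
  set n := Nat.find hex
  have hn : ¬ S ≤ B'.comap (k ^ n) := Nat.find_spec hex
  have hlt : ∀ m < n, S ≤ B'.comap (k ^ m) := fun m hm => not_not.1 (Nat.find_min hex hm)
  have hinj : ∀ m ≤ n, ∀ x ∈ S, (k ^ m) x = 0 → x = 0 := by
    intro m
    induction m with
    | zero => intro _ x _ h; simpa using h
    | succ m ih =>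
      intro hm x hx h
      refine ih (by omega) x hx ?_
      refine (hmem _ (hlt m (by omega) hx)).2 0 B'.zero_mem ?_
      rw [pow_succ'] at h
      rw [k.map_zero]
      exact h
  have hdis : S ⊓ B'.comap (k ^ n) = ⊥ :=
    (hS.le_iff.1 inf_le_left).resolve_right fun h => hn (inf_eq_left.1 h)
  let s : A →ₗ.[R] A := ⟨S, (k ^ n).domRestrict S⟩
  have hs : Disjoint f.domain s.domain := hd
  have hag := f.sup_h_of_disjoint s hs
  refine ⟨f.sup s hag, f.left_le_sup s hag, ?_, ?_⟩
  · refine lt_of_le_of_ne le_sup_left fun h => hS.1 ?_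
    exact disjoint_self.1 (hd.mono_left (le_sup_right.trans h.ge))
  · change Injective (f.sup s hag).toFun
    rw [injective_iff_map_eq_zero]
    rintro ⟨z, hz⟩ h
    obtain ⟨x, hx, y, hy, rfl⟩ := mem_sup.1 hz
    have hsum : f ⟨x, hx⟩ + (k ^ n) y = 0 :=
      (f.sup_apply hag ⟨x, hx⟩ ⟨y, hy⟩ ⟨x + y, hz⟩ rfl).symm.trans h
    have hyB : (k ^ n) y ∈ B' := by
      rw [eq_neg_of_add_eq_zero_right hsum]
      exact B'.neg_mem ⟨⟨x, hx⟩, rfl⟩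
    have hy0 : y = 0 := by
      have : y ∈ S ⊓ B'.comap (k ^ n) := ⟨hy, hyB⟩
      simpa [hdis] using this
    subst hy0
    have hx0 : (⟨x, hx⟩ : f.domain) = 0 := hf (by simpa using hsum)
    have hx0' : x = 0 := congrArg Subtype.val hx0
    exact Subtype.ext (by simp [hx0'])

/-- In a finite pseudo-injective module, every injective partial linear map extends to an
automorphism. -/
theorem PseudoInjective.exists_linearEquiv_extend
    {R A : Type*} [Ring R] [AddCommGroup A] [Finite A] [Module R A]
    (hpi : PseudoInjective R A) (f : A →ₗ.[R] A) (hf : Injective f) :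
    ∃ τ : A ≃ₗ[R] A, ∀ x : f.domain, τ x = f x := by
  obtain ⟨B, hB⟩ : ∃ B, B = f.domain := ⟨_, rfl⟩
  induction B using WellFoundedGT.induction generalizing f with
  | ind B ih =>
    subst hB
    obtain ⟨h, hh⟩ := hpi f.domain f.toFun hf
    by_cases hker : LinearMap.ker h = ⊥
    · have hinj : Injective h := LinearMap.ker_eq_bot.1 hker
      exact ⟨LinearEquiv.ofBijective h (Finite.injective_iff_bijective.1 hinj), hh⟩
    · let e := LinearEquiv.ofInjective f.toFun hf
      obtain ⟨k, hk⟩ := hpi (LinearMap.range f.toFun) (f.domain.subtype ∘ₗ e.symm.toLinearMap)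
        (f.domain.injective_subtype.comp e.symm.injective)
      have hkf : ∀ x : f.domain, k (f x) = x := fun x =>
        (hk (e x)).trans (congrArg Subtype.val (e.symm_apply_apply x))
      have hd : Disjoint f.domain (LinearMap.ker h) := by
        rw [Submodule.disjoint_def]
        intro x hx hx0
        have : f ⟨x, hx⟩ = 0 := (hh ⟨x, hx⟩).symm.trans hx0
        exact congrArg Subtype.val (hf (this.trans f.map_zero.symm))
      obtain ⟨g, hfg, hlt, hg⟩ :=
        f.exists_injective_lt_of_not_essential hf k hkf _ hker hd
      obtain ⟨τ, hτ⟩ := ih g.domain hlt g hg rfl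
      exact ⟨τ, fun x => (hτ ⟨x, hfg.1 x.2⟩).trans (hfg.2 rfl).symm⟩

/-- In a finite pseudo-injective left module `A` over a finite ring `R`, two elements have equal
annihilators iff they lie in the same `Aut_R(A)`-orbit. -/
theorem elemAnn_eq_iff_exists_aut
    (R : Type*) [Ring R] [Finite R] (A : Type*) [AddCommGroup A] [Finite A] [Module R A]
    (hpi : PseudoInjective R A) (a b : A) :
    elemAnn R a = elemAnn R b ↔ ∃ τ : A ≃ₗ[R] A, a = τ b := by
  constructor
  · intro hab
    have hiff : ∀ r : R, r • a = 0 ↔ r • b = 0 := fun r => SetLike.ext_iff.1 hab r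
    let f : A →ₗ.[R] A :=
      LinearPMap.mkSpanSingleton' b a fun r hr => (hiff r).2 hr
    have hf : Injective f := by
      change Injective f.toFun
      rw [injective_iff_map_eq_zero]
      rintro ⟨x, hx⟩ h
      obtain ⟨r, rfl⟩ := Submodule.mem_span_singleton.1 hx
      have hr : r • a = 0 := (LinearPMap.mkSpanSingleton'_apply b a _ r hx).symm.trans h
      exact Subtype.ext ((hiff r).1 hr)
    obtain ⟨τ, hτ⟩ := hpi.exists_linearEquiv_extend f hf
    have hb : b ∈ f.domain := Submodule.mem_span_singleton_self b
    exact ⟨τ, ((hτ ⟨b, hb⟩).trans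
      (LinearPMap.mkSpanSingleton'_apply_self b a _ hb)).symm⟩
  · rintro ⟨τ, rfl⟩
    ext r
    change r • τ b = 0 ↔ r • b = 0
    rw [← map_smul, map_eq_zero_iff τ τ.injective]
end

section
/- Let R be a finite ring with unity and A a finite pseudo-injective left R-module. Then A has the extension property with respect to the symmetrized weight composition built on Aut_R(A) if and only if A has the extension property with respect to the annihilator weight aw. -/
open Function

/-- In a finite module, an embedding of a submodule `B` extends to any simple submodule that meets
`B` trivially. -/
theorem exists_injective_coprod_of_isAtom {R A : Type*} [Ring R] [AddCommGroup A] [Finite A]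
    [Module R A] {B S : Submodule R A} (hS : IsAtom S) (hSB : Disjoint B S)
    {g : B →ₗ[R] A} (hg : Injective g) :
    ∃ φ : S →ₗ[R] A, Injective (g.coprod φ) := by
  have : IsSimpleModule R S := isSimpleModule_iff_isAtom.2 hS
  have : Finite (S →ₗ[R] A) := Finite.of_injective _ DFunLike.coe_injective
  -- If every map `S → A` had image in `range g`, then `ψ` would be an injective self-map
  -- of the finite set `S →ₗ[R] A` that misses the inclusion of `S`.
  obtain ⟨φ, hφ⟩ : ∃ φ : S →ₗ[R] A, ¬ LinearMap.range φ ≤ LinearMap.range g := by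
    by_contra! hall
    let e := LinearEquiv.ofInjective g hg
    let ψ : (S →ₗ[R] A) → (S →ₗ[R] A) := fun φ =>
      B.subtype ∘ₗ e.symm.toLinearMap ∘ₗ
        φ.codRestrict (LinearMap.range g) fun s => hall φ ⟨s, rfl⟩
    have hψ : Injective ψ := fun φ₁ φ₂ h => by
      ext s
      have hs := e.symm.injective (Subtype.ext (LinearMap.congr_fun h s))
      exact congrArg Subtype.val hs
    obtain ⟨φ, hφ⟩ := Finite.surjective_of_injective hψ S.subtype
    refine hS.1 (disjoint_self.1 (hSB.mono_left fun s hs => ?_))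
    have hs' : ψ φ ⟨s, hs⟩ = s := LinearMap.congr_fun hφ ⟨s, hs⟩
    rw [← hs']
    exact Subtype.property _
  have hcomap : (LinearMap.range g).comap φ = ⊥ :=
    (eq_bot_or_eq_top _).resolve_right fun h =>
      hφ (by rw [LinearMap.range_eq_map, Submodule.map_le_iff_le_comap, h])
  refine ⟨φ, (injective_iff_map_eq_zero _).2 ?_⟩
  rintro ⟨b, s⟩ hbs
  rw [LinearMap.coprod_apply] at hbs
  have hs : s = 0 := by
    rw [← Submodule.mem_bot R, ← hcomap, Submodule.mem_comap]
    exact ⟨-b, by rw [map_neg]; exact neg_eq_of_add_eq_zero_right hbs⟩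
  have hb : b = 0 := hg (by simpa [hs] using hbs)
  rw [hs, hb, Prod.mk_zero_zero]

/-- In a finite pseudo-injective module, every embedding of a submodule extends to an injective
endomorphism. -/
theorem PseudoInjective.exists_injective_extension {R A : Type*} [Ring R] [AddCommGroup A]
    [Finite A] [Module R A] (hpi : PseudoInjective R A) (B : Submodule R A)
    (g : B →ₗ[R] A) (hg : Injective g) :
    ∃ h : A →ₗ[R] A, Injective h ∧ ∀ b : B, h b = g b := by
  induction B using WellFoundedGT.induction with
  | ind B ih =>
    by_cases hB : ∃ S : Submodule R A, IsAtom S ∧ Disjoint B S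
    · obtain ⟨S, hS, hBS⟩ := hB
      obtain ⟨φ, hφ⟩ := exists_injective_coprod_of_isAtom hS hBS hg
      have hi : Injective (B.subtype.coprod S.subtype) := by
        rw [← LinearMap.ker_eq_bot, LinearMap.ker_coprod_of_disjoint_range _ _ (by simpa)]
        simp
      let e := LinearEquiv.ofInjective _ hi
      have hlt : B < LinearMap.range (B.subtype.coprod S.subtype) := by
        rw [LinearMap.range_coprod, Submodule.range_subtype, Submodule.range_subtype,
          left_lt_sup]
        exact fun h => hS.1 (disjoint_self.1 (hBS.mono_left h))
      obtain ⟨h, hinj, hh⟩ :=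
        ih _ hlt (g.coprod φ ∘ₗ e.symm.toLinearMap) (hφ.comp e.symm.injective)
      refine ⟨h, hinj, fun b => ?_⟩
      simpa [e] using hh (e (b, 0))
    · push Not at hB
      obtain ⟨h, hh⟩ := hpi B g hg
      refine ⟨h, LinearMap.ker_eq_bot.1 ?_, hh⟩
      obtain hker | ⟨S, hS, hle⟩ := eq_bot_or_exists_atom_le (LinearMap.ker h)
      · exact hker
      · refine absurd (Disjoint.mono_right hle (Submodule.disjoint_def.2 fun b hb hb0 => ?_))
          (hB S hS)
        have : g ⟨b, hb⟩ = 0 := (hh ⟨b, hb⟩).symm.trans hb0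
        exact congrArg Subtype.val (hg (this.trans (map_zero g).symm))

/-- In a finite pseudo-injective module, two elements have the same annihilator if and only if
they lie in the same orbit of the automorphism group. -/
theorem PseudoInjective.elemAnn_eq_iff {R A : Type*} [Ring R] [AddCommGroup A] [Finite A]
    [Module R A] (hpi : PseudoInjective R A) (a b : A) :
    elemAnn R a = elemAnn R b ↔ ∃ τ : A ≃ₗ[R] A, a = τ b := by
  constructor
  · intro hab
    have hker : LinearMap.ker (LinearMap.toSpanSingleton R A b) =
        LinearMap.ker (LinearMap.toSpanSingleton R A a) := hab.symm
    let p := LinearMap.toSpanSingleton R A b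
    let q := (LinearMap.ker p).liftQ (LinearMap.toSpanSingleton R A a) hker.le
    have hq : Injective q :=
      LinearMap.ker_eq_bot.1 (Submodule.ker_liftQ_eq_bot _ _ _ hker.ge)
    let e := p.quotKerEquivRange
    obtain ⟨h, hinj, hh⟩ := hpi.exists_injective_extension (LinearMap.range p)
      (q ∘ₗ e.symm.toLinearMap) (hq.comp e.symm.injective)
    have hab' : a = h b := by
      simpa [e, q, p] using (hh (e (Submodule.Quotient.mk 1))).symm
    exact ⟨LinearEquiv.ofBijective h ⟨hinj, Finite.surjective_of_injective hinj⟩, hab'⟩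
  · rintro ⟨τ, rfl⟩
    ext r
    change r • τ b = 0 ↔ r • b = 0
    rw [← map_smul, LinearEquiv.map_eq_zero_iff]

/-- In a finite pseudo-injective module, the symmetrized weight composition built on the full
automorphism group is the annihilator weight. -/
theorem PseudoInjective.swc_top_eq_aw {R A : Type*} [Ring R] [AddCommGroup A] [Finite A]
    [Module R A] (hpi : PseudoInjective R A) {n : ℕ} (x : Fin n → A) (a : A) :
    swc R ⊤ x a = aw R x a := by
  simp only [swc, aw, hpi.elemAnn_eq_iff, Subgroup.mem_top, true_and]


/-- For a finite pseudo-injective module, the extension property with respect to the symmetrized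
weight composition built on `Aut_R(A)` is equivalent to the extension property with respect to
the annihilator weight. -/
theorem ep_swc_iff_ep_aw_of_pseudoInjective
    (R : Type*) [Ring R] [Finite R] (A : Type*) [AddCommGroup A] [Finite A] [Module R A]
    (hpi : PseudoInjective R A) :
    HasEPswc R A (⊤ : Subgroup (A ≃ₗ[R] A)) ↔ HasEPaw R A := by
  simp only [HasEPswc, HasEPaw, hpi.swc_top_eq_aw]
end

section
/- Let R be a finite chain ring (a finite ring with unity whose left ideals form a chain under inclusion) and A a finite left R-module. If C ⊆ A^n is a linear code and f : C → A^n is an injective R-linear map preserving Hamming weight, then f preserves the annihilator weight aw: for every x ∈ C and a ∈ A, |{i : Ann(f(x)_i) = Ann(a)}| = |{i : Ann(x_i) = Ann(a)}|. -/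
open Function

theorem mem_elemAnn {R : Type*} [Ring R] {A : Type*} [AddCommGroup A] [Module R A] {a : A}
    {r : R} : r ∈ elemAnn R a ↔ r • a = 0 := Iff.rfl

/-- Every left ideal of a finite chain ring is principal. -/
theorem IsChainRing.exists_eq_span_singleton {R : Type*} [Ring R] [Finite R]
    (h : IsChainRing R) (I : Submodule R R) : ∃ r, I = Submodule.span R {r} := by
  obtain ⟨r, hr⟩ := Set.Finite.exists_maximalFor (fun r : R => Submodule.span R {r}) (I : Set R)
    (Set.toFinite _) ⟨0, I.zero_mem⟩
  refine ⟨r, le_antisymm (fun s hs => ?_) ((Submodule.span_singleton_le_iff_mem r I).2 hr.1)⟩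
  rw [← Submodule.span_singleton_le_iff_mem]
  exact (h (Submodule.span R {s}) (Submodule.span R {r})).elim id (hr.2 hs)

/-- The zero and nonzero components of a word together account for its length. -/
theorem ncard_zero_add_hwt {A : Type*} [Zero A] {n : ℕ} (x : Fin n → A) :
    {i | x i = 0}.ncard + hwt x = n := by
  change _ + {i | x i = 0}ᶜ.ncard = n
  rw [Set.ncard_add_ncard_compl, Nat.card_fin]

/-- The components of a word whose annihilator contains a principal left ideal are the zero
components of the corresponding multiple of the word. -/
theorem ncard_span_singleton_le_elemAnn_add_hwt {R : Type*} [Ring R] {A : Type*}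
    [AddCommGroup A] [Module R A] {n : ℕ} (x : Fin n → A) (r : R) :
    {i | Submodule.span R {r} ≤ elemAnn R (x i)}.ncard + hwt (r • x) = n := by
  simpa [Submodule.span_singleton_le_iff_mem, mem_elemAnn] using ncard_zero_add_hwt (r • x)

/-- In a finite chain ring, the left ideals strictly above a proper left ideal `J` are those above
a single left ideal. -/
theorem IsChainRing.exists_forall_lt_iff_le {R : Type*} [Ring R] [Finite R]
    (h : IsChainRing R) {J : Submodule R R} (hJ : J ≠ ⊤) :
    ∃ K, ∀ I, J < I ↔ K ≤ I := by
  obtain ⟨K, hK⟩ := Set.Finite.exists_minimal (s := {I : Submodule R R | J < I})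
    (Set.toFinite _) ⟨⊤, hJ.lt_top⟩
  exact ⟨K, fun I => ⟨fun hI => (h K I).elim id (hK.2 hI), hK.1.trans_le⟩⟩

theorem aw_add_ncard_lt {R : Type*} [Ring R] {A : Type*} [AddCommGroup A] [Module R A] {n : ℕ}
    (x : Fin n → A) (a : A) :
    aw R x a + {i | elemAnn R a < elemAnn R (x i)}.ncard =
      {i | elemAnn R a ≤ elemAnn R (x i)}.ncard := by
  change {i | elemAnn R (x i) = elemAnn R a}.ncard + _ = _
  have hd : Disjoint {i | elemAnn R (x i) = elemAnn R a} {i | elemAnn R a < elemAnn R (x i)} :=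
    Set.disjoint_left.2 fun i hi hlt => hlt.ne hi.symm
  rw [← Set.ncard_union_eq hd]
  congr 1
  ext i
  simp only [Set.mem_union, Set.mem_ofPred_eq, le_iff_eq_or_lt, eq_comm]

/-- Over a finite chain ring, an injective linear Hamming-weight-preserving map between codes
preserves the annihilator weight. -/
theorem aw_preserved_of_hamming_preserved_chainRing
    (R : Type*) [Ring R] [Finite R] (hchain : IsChainRing R)
    (A : Type*) [AddCommGroup A] [Finite A] [Module R A]
    (n : ℕ) (C : Submodule R (Fin n → A)) (f : C →ₗ[R] (Fin n → A))
    (hinj : Injective f) (hw : ∀ x : C, hwt (f x) = hwt (x : Fin n → A)) :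
    ∀ (x : C) (a : A), aw R (f x) a = aw R (x : Fin n → A) a := by
  intro x a
  have key (I : Submodule R R) : {i | I ≤ elemAnn R (f x i)}.ncard =
      {i | I ≤ elemAnn R ((x : Fin n → A) i)}.ncard := by
    obtain ⟨r, rfl⟩ := hchain.exists_eq_span_singleton I
    have hf := ncard_span_singleton_le_elemAnn_add_hwt (f x) r
    have hx := ncard_span_singleton_le_elemAnn_add_hwt (x : Fin n → A) r
    have hr := hw (r • x)
    rw [map_smul, Submodule.coe_smul] at hr
    omega
  have hlt : {i | elemAnn R a < elemAnn R (f x i)}.ncard =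
      {i | elemAnn R a < elemAnn R ((x : Fin n → A) i)}.ncard := by
    by_cases hJ : elemAnn R a = ⊤
    · simp [hJ]
    · obtain ⟨K, hK⟩ := hchain.exists_forall_lt_iff_le hJ
      simpa only [hK] using key K
  have hf := aw_add_ncard_lt (R := R) (f x) a
  have hx := aw_add_ncard_lt (R := R) (x : Fin n → A) a
  have ha := key (elemAnn R a)
  omega
end

section
/- Let R be a finite ring with unity and A a finite left R-module. Then A can be embedded in the character module R̂ as a left R-module if and only if the socle of A is a cyclic R-module. -/
open Function

/-- The socle of a module: the sum of all its simple submodules. -/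
def moduleSocle (R : Type*) [Ring R] (A : Type*) [AddCommGroup A] [Module R A] :
    Submodule R A :=
  sSup {S : Submodule R A | IsSimpleModule R S}

/-- An additive character of a left `R`-module is generating if its kernel contains no nonzero
submodule. -/
def IsGeneratingChar (R : Type*) [Ring R] {M : Type*} [AddCommGroup M] [Module R M]
    (χ : M →+ AddCircle (1 : ℚ)) : Prop :=
  ∀ m : M, (∀ r : R, χ (r • m) = 0) → m = 0

theorem embedsInCharacterModule_iff_exists_isGeneratingChar (R : Type*) [Ring R]
    (A : Type*) [AddCommGroup A] [Module R A] :
    EmbedsInCharacterModule R A ↔ ∃ χ : A →+ AddCircle (1 : ℚ), IsGeneratingChar R χ := by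
  constructor
  · rintro ⟨ι, hι, h⟩
    refine ⟨(AddMonoidHom.eval (1 : R)).comp ι, fun a ha => ?_⟩
    refine (injective_iff_map_eq_zero ι).1 hι a (AddMonoidHom.ext fun x => ?_)
    simpa [h] using ha x
  · rintro ⟨χ, hχ⟩
    refine ⟨AddMonoidHom.mk' (fun a => χ.comp ((AddMonoidHom.flip (smulAddHom R A)) a)) ?_,
      ?_, ?_⟩
    · intro a b
      ext x
      simp
    · refine (injective_iff_map_eq_zero _).2 fun a ha => hχ a fun r => ?_
      simpa using DFunLike.congr_fun ha r
    · intro r a x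
      simp [mul_smul]

theorem IsGeneratingChar.comp {R M N : Type*} [Ring R] [AddCommGroup M] [Module R M]
    [AddCommGroup N] [Module R N] {χ : N →+ AddCircle (1 : ℚ)} (hχ : IsGeneratingChar R χ)
    (f : M →ₗ[R] N) (hf : Injective f) : IsGeneratingChar R (χ.comp f.toAddMonoidHom) :=
  fun m hm => (injective_iff_map_eq_zero f).1 hf m <| hχ _ fun r => by simpa using hm r

/-- A finite abelian group has at most as many characters as elements. -/
theorem card_addMonoidHom_addCircle_le (G : Type*) [AddCommGroup G] [Finite G] :
    Finite (G →+ AddCircle (1 : ℚ)) ∧ Nat.card (G →+ AddCircle (1 : ℚ)) ≤ Nat.card G := by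
  let c : AddCircle (1 : ℚ) →+ AddCircle (1 : ℝ) :=
    QuotientAddGroup.map _ _ (Rat.castHom ℝ).toAddMonoidHom (by
      rw [AddSubgroup.zmultiples_le]
      exact ⟨1, by simp⟩)
  have hc : Injective c := by
    refine (injective_iff_map_eq_zero c).2 fun x => ?_
    obtain ⟨q, rfl⟩ := QuotientAddGroup.mk_surjective x
    intro h
    obtain ⟨n, hn⟩ := (AddCircle.coe_eq_zero_iff (p := (1 : ℝ)) (x := (q : ℝ))).1 h
    refine (AddCircle.coe_eq_zero_iff (p := (1 : ℚ))).2 ⟨n, ?_⟩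
    simp only [zsmul_eq_mul, mul_one] at hn ⊢
    exact_mod_cast hn
  let F : (G →+ AddCircle (1 : ℚ)) → AddChar G ℂ := fun φ =>
    { toFun := fun g => (AddCircle.toCircle (c (φ g)) : ℂ)
      map_zero_eq_one' := by simp
      map_add_eq_mul' := fun a b => by simp [AddCircle.toCircle_add] }
  have hF : Injective F := fun φ ψ h => AddMonoidHom.ext fun g =>
    hc <| AddCircle.injective_toCircle one_ne_zero <| Subtype.ext <| DFunLike.congr_fun h g
  cases nonempty_fintype G
  refine ⟨Finite.of_injective F hF, (Nat.card_le_card_of_injective F hF).trans ?_⟩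
  rw [Nat.card_eq_fintype_card, Nat.card_eq_fintype_card, AddChar.card_eq]

/-- A generating character of a finite ring induces a surjection onto the character module. -/
theorem IsGeneratingChar.exists_eq_apply_mul {B : Type*} [Ring B] [Finite B]
    {χ : B →+ AddCircle (1 : ℚ)} (hχ : IsGeneratingChar B χ) (φ : B →+ AddCircle (1 : ℚ)) :
    ∃ b : B, ∀ x, φ x = χ (x * b) := by
  let F : B → (B →+ AddCircle (1 : ℚ)) := fun b => χ.comp (AddMonoidHom.mulRight b)
  have hF : Injective F := fun a b h => by
    rw [← sub_eq_zero]
    refine hχ _ fun r => ?_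
    have := DFunLike.congr_fun h r
    simpa [F, mul_sub, sub_eq_zero] using this
  obtain ⟨_, hle⟩ := card_addMonoidHom_addCircle_le B
  obtain ⟨b, hb⟩ := (hF.bijective_of_nat_card_le hle).surjective φ
  exact ⟨b, fun x => (DFunLike.congr_fun hb x).symm⟩

/-- A finite semisimple ring is Frobenius: the sum of the traces of its simple factors, composed
with nonzero characters of the division rings involved, is generating. -/
theorem exists_isGeneratingChar_of_isSemisimpleRing (B : Type*) [Ring B]
    [IsSemisimpleRing B] : ∃ χ : B →+ AddCircle (1 : ℚ), IsGeneratingChar B χ := by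
  obtain ⟨n, D, d, _, _, ⟨e⟩⟩ := IsSemisimpleRing.exists_ringEquiv_pi_matrix_divisionRing B
  have key (i : Fin n) : ∃ c : D i →+ AddCircle (1 : ℚ), c 1 ≠ 0 :=
    CharacterModule.exists_character_apply_ne_zero_of_ne_zero one_ne_zero
  choose ψ hψ using key
  let χ : (Π i, Matrix (Fin (d i)) (Fin (d i)) (D i)) →+ AddCircle (1 : ℚ) :=
    ∑ i, ((ψ i).comp (Matrix.traceAddMonoidHom (Fin (d i)) (D i))).comp (Pi.evalAddMonoidHom _ i)
  refine ⟨χ.comp e.toAddMonoidHom, fun b hb => ?_⟩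
  rw [← e.map_eq_zero_iff]
  by_contra hne
  have : ∃ i k l, e b i k l ≠ 0 := by
    by_contra! h
    exact hne (funext fun i => Matrix.ext (h i))
  obtain ⟨i, k, l, hkl⟩ := this
  apply hψ i
  have hχe (y) : χ (y * e b) = 0 := by
    have := hb (e.symm y)
    rwa [smul_eq_mul, AddMonoidHom.comp_apply,
      show e.toAddMonoidHom (e.symm y * b) = y * e b by simp] at this
  have h := hχe (Pi.single i (Matrix.single l k (e b i k l)⁻¹))
  simp only [χ, AddMonoidHom.finsetSum_apply, AddMonoidHom.comp_apply,
    Pi.evalAddMonoidHom_apply, Pi.mul_apply, Matrix.traceAddMonoidHom_apply] at h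
  rw [Finset.sum_eq_single i] at h
  · simpa [Matrix.trace_single_mul, hkl] using h
  · intro j _ hj
    simp [Pi.single_eq_of_ne hj]
  · simp

instance isSemisimpleModule_moduleSocle (R : Type*) [Ring R] (A : Type*) [AddCommGroup A]
    [Module R A] : IsSemisimpleModule R (moduleSocle R A) := by
  rw [moduleSocle, sSup_eq_iSup]
  exact isSemisimpleModule_biSup_of_isSemisimpleModule_submodule fun S hS => by
    have : IsSimpleModule R S := hS
    infer_instance

/-- Every nonzero submodule of a finite module meets the socle, so that generating characters
can be extended from the socle. -/
theorem exists_isGeneratingChar_iff_moduleSocle (R : Type*) [Ring R] (A : Type*)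
    [AddCommGroup A] [Finite A] [Module R A] :
    (∃ χ : A →+ AddCircle (1 : ℚ), IsGeneratingChar R χ) ↔
      ∃ χ : moduleSocle R A →+ AddCircle (1 : ℚ), IsGeneratingChar R χ := by
  constructor
  · rintro ⟨χ, hχ⟩
    exact ⟨_, hχ.comp (moduleSocle R A).subtype Subtype.val_injective⟩
  · rintro ⟨χ, hχ⟩
    obtain ⟨χ', h⟩ := (Module.Baer.of_divisible (AddCircle (1 : ℚ))).extension_property_addMonoidHom
      (moduleSocle R A).subtype.toAddMonoidHom Subtype.val_injective χ
    refine ⟨χ', fun a ha => ?_⟩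
    by_contra hne
    obtain h0 | ⟨T, hT, hTa⟩ := IsAtomic.eq_bot_or_exists_atom_le (Submodule.span R {a})
    · exact hne (by simpa using h0)
    · have hTS : T ≤ moduleSocle R A := le_sSup (isSimpleModule_iff_isAtom.2 hT)
      obtain ⟨t, ht, ht0⟩ := T.ne_bot_iff.1 hT.1
      obtain ⟨r, rfl⟩ := Submodule.mem_span_singleton.1 (hTa ht)
      refine ht0 (congrArg Subtype.val (hχ ⟨r • a, hTS ht⟩ fun s => ?_))
      rw [← h]
      simpa [mul_smul] using ha (s * r)

instance isSemisimpleModule_quotient_jacobson (R : Type*) [Ring R] [IsArtinianRing R] :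
    IsSemisimpleModule R (R ⧸ Ring.jacobson R) :=
  (IsArtinian.isSemisimpleModule_iff_jacobson R _).2 (Module.jacobson_quotient_jacobson R R)

/-- A semisimple module over an Artinian ring is cyclic iff it embeds in the quotient of the ring
by its Jacobson radical. -/
theorem isCyclic_iff_embeds_quotient_jacobson (R : Type*) [Ring R] [IsArtinianRing R] (S : Type*)
    [AddCommGroup S] [Module R S] [IsSemisimpleModule R S] :
    (∃ s : S, Submodule.span R {s} = ⊤) ↔
      ∃ f : S →ₗ[R] R ⧸ Ring.jacobson R, Injective f := by
  constructor
  · rintro ⟨s, hs⟩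
    let g : (R ⧸ Ring.jacobson R) →ₗ[R] S :=
      (Ring.jacobson R).liftQ (LinearMap.toSpanSingleton R S s) fun r hr =>
        Module.mem_annihilator.1 (IsSemisimpleModule.jacobson_le_annihilator R S hr) s
    have hg : Surjective g := fun x => by
      obtain ⟨r, rfl⟩ := Submodule.mem_span_singleton.1 (hs ▸ Submodule.mem_top : x ∈ _)
      exact ⟨Submodule.Quotient.mk r, rfl⟩
    obtain ⟨f, hf⟩ := IsSemisimpleModule.lifting_property g hg LinearMap.id
    exact ⟨f, LeftInverse.injective (g := g) fun x => LinearMap.congr_fun hf x⟩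
  · rintro ⟨f, hf⟩
    obtain ⟨g, hg⟩ := IsSemisimpleModule.extension_property f hf LinearMap.id
    refine ⟨g (Submodule.Quotient.mk 1), eq_top_iff.2 fun x _ => ?_⟩
    obtain ⟨r, hr⟩ := Submodule.Quotient.mk_surjective _ (f x)
    refine Submodule.mem_span_singleton.2 ⟨r, ?_⟩
    rw [← map_smul, ← Submodule.Quotient.mk_smul, smul_eq_mul, mul_one, hr]
    exact LinearMap.congr_fun hg x

theorem exists_isGeneratingChar_iff_embeds_quotient_jacobson (R : Type*) [Ring R] [Finite R]
    (S : Type*) [AddCommGroup S] [Module R S] [IsSemisimpleModule R S] :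
    (∃ χ : S →+ AddCircle (1 : ℚ), IsGeneratingChar R χ) ↔
      ∃ f : S →ₗ[R] R ⧸ Ring.jacobson R, Injective f := by
  have : Finite (R ⧸ Ring.jacobson R) := Quotient.finite _
  obtain ⟨χ, hχ⟩ := exists_isGeneratingChar_of_isSemisimpleRing (R ⧸ Ring.jacobson R)
  have smul_eq (r : R) (b : R ⧸ Ring.jacobson R) :
      r • b = Ideal.Quotient.mk (Ring.jacobson R) r * b := by
    obtain ⟨b, rfl⟩ := Ideal.Quotient.mk_surjective b
    rfl
  have eq_zero (b : R ⧸ Ring.jacobson R)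
      (hb : ∀ r : R, χ (Ideal.Quotient.mk (Ring.jacobson R) r * b) = 0) : b = 0 :=
    hχ b fun x => by
      obtain ⟨r, rfl⟩ := Ideal.Quotient.mk_surjective x
      exact hb r
  constructor
  · rintro ⟨θ, hθ⟩
    have key (s : S) : ∃ b : R ⧸ Ring.jacobson R,
        ∀ r : R, θ (r • s) = χ (Ideal.Quotient.mk (Ring.jacobson R) r * b) := by
      have hJ (r : R) (hr : r ∈ (Ring.jacobson R).toAddSubgroup) :
          (θ.comp ((AddMonoidHom.flip (smulAddHom R S)) s)) r = 0 := by
        have := Module.mem_annihilator.1 (IsSemisimpleModule.jacobson_le_annihilator R S hr) s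
        simp [this]
      obtain ⟨b, hb⟩ := hχ.exists_eq_apply_mul (QuotientAddGroup.lift _ _ hJ)
      exact ⟨b, fun r => hb (Ideal.Quotient.mk _ r)⟩
    choose f hf using key
    refine ⟨{ toFun := f, map_add' := fun s t => ?_, map_smul' := fun r s => ?_ }, ?_⟩
    · rw [← sub_eq_zero]
      refine eq_zero _ fun r => ?_
      simp [mul_sub, mul_add, ← hf]
    · rw [← sub_eq_zero]
      refine eq_zero _ fun x => ?_
      simp only [RingHom.id_apply, smul_eq, mul_sub, ← mul_assoc, ← map_mul, map_sub, ← hf,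
        mul_smul, sub_self]
    · refine (injective_iff_map_eq_zero _).2 fun s hs => hθ s fun r => ?_
      rw [hf, show f s = 0 from hs, mul_zero, map_zero]
  · rintro ⟨f, hf⟩
    have hχR : IsGeneratingChar R χ := fun b hb => eq_zero b fun r => by
      rw [← smul_eq]
      exact hb r
    exact ⟨_, hχR.comp f hf⟩

/-- A finite left module `A` over a finite ring `R` embeds in the character module `R̂` iff its
socle is cyclic. -/
theorem embeds_in_character_module_iff_cyclic_socle
    (R : Type*) [Ring R] [Finite R] (A : Type*) [AddCommGroup A] [Finite A] [Module R A] :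
    EmbedsInCharacterModule R A ↔ ∃ a : A, moduleSocle R A = Submodule.span R {a} := by
  rw [embedsInCharacterModule_iff_exists_isGeneratingChar,
    exists_isGeneratingChar_iff_moduleSocle,
    exists_isGeneratingChar_iff_embeds_quotient_jacobson,
    ← isCyclic_iff_embeds_quotient_jacobson]
  have span_eq_top_iff (s : moduleSocle R A) :
      Submodule.span R {s} = ⊤ ↔ moduleSocle R A = Submodule.span R {(s : A)} := by
    rw [← (Submodule.map_injective_of_injective (moduleSocle R A).subtype_injective).eq_iff,
      Submodule.map_span, Set.image_singleton, Submodule.map_subtype_top, eq_comm]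
    rfl
  constructor
  · rintro ⟨s, hs⟩
    exact ⟨s, (span_eq_top_iff s).1 hs⟩
  · rintro ⟨a, ha⟩
    exact ⟨⟨a, ha ▸ Submodule.mem_span_singleton_self a⟩, (span_eq_top_iff _).2 ha⟩
end
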